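/- Let r = X → Y be a totally-ordered sequential rule over a sequence database D, and let r' be a ToSR obtained from r by a right I-expansion or a right S-expansion with an item i. Then the three right-expansion upper bounds form a chain: RERSPEU(r') ≤ RERSU(r') ≤ REPEU(r), where RERSU(r') = Σ_{s ∈ seq(r')} REPEU(r, s). -/

import Mathlib

open scoped Classical

noncomputable section

namespace TotalSR

variable {I : Type*} [LinearOrder I]

/-- A sequence: a list of itemsets. -/
abbrev Seqc (I : Type*) := List (Finset I)

/-- The set of items occurring in a sequence. -/
def itemsOf (s : Seqc I) : Finset I := s.foldr (· ∪ ·) ∅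

/-- Well-formed sequence: nonempty, all itemsets nonempty, and each item
occurs at most once (itemsets pairwise disjoint). -/
def WFSeq (s : Seqc I) : Prop :=
  s ≠ [] ∧ (∀ e ∈ s, e.Nonempty) ∧ s.Pairwise fun a b => Disjoint a b

/-- `s₁` occurs in `s₂` (written s₁ ⊑ s₂): there exist strictly increasing
indices matching each itemset of `s₁` into a superset itemset of `s₂`. -/
def OccursIn (s₁ s₂ : Seqc I) : Prop :=
  ∃ t : List (Finset I), t.Sublist s₂ ∧ List.Forall₂ (· ⊆ ·) s₁ t

/-- The rule X → Y occurs in s: there is a split position 1 ≤ k < |s|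
with X occurring in the first k itemsets and Y in the remaining ones. -/
def RuleOccursIn (X Y s : Seqc I) : Prop :=
  ∃ k, 1 ≤ k ∧ k < s.length ∧ OccursIn X (s.take k) ∧ OccursIn Y (s.drop k)

/-- seq(r): the sequences of the database D in which the rule X → Y occurs. -/
def seqL (D : List (Seqc I)) (X Y : Seqc I) : List (Seqc I) :=
  D.filter fun s => decide (RuleOccursIn X Y s)

/-- ant(r): the sequences of the database D in which the antecedent X occurs. -/
def antL (D : List (Seqc I)) (X : Seqc I) : List (Seqc I) :=
  D.filter fun s => decide (OccursIn X s)

/-- conf(r) = |seq(r)| / |ant(r)|. -/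
def conf (D : List (Seqc I)) (X Y : Seqc I) : ℝ :=
  ((seqL D X Y).length : ℝ) / ((antL D X).length : ℝ)

variable (q : I → Seqc I → ℝ) (iu : I → ℝ)

/-- u(i, s) = q(i, s) · iu(i). -/
def itemUtil (j : I) (s : Seqc I) : ℝ := q j s * iu j

/-- u(r, s): the sum of u(i, s) over all items occurring in X or Y. -/
def ruleUtilIn (X Y s : Seqc I) : ℝ :=
  ∑ j ∈ itemsOf X ∪ itemsOf Y, itemUtil q iu j s

/-- u(r) = Σ_{s ∈ seq(r)} u(r, s). -/
def ruleUtil (D : List (Seqc I)) (X Y : Seqc I) : ℝ :=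
  ((seqL D X Y).map (ruleUtilIn q iu X Y)).sum

/-- I-extension of a sequence: insert item i into the last itemset. -/
def iExt (X : Seqc I) (i : I) : Seqc I := X.dropLast ++ [insert i (X.getLastD ∅)]

/-- S-extension of a sequence: append the singleton itemset {i}. -/
def sExt (X : Seqc I) (i : I) : Seqc I := X ++ [{i}]

/-- X' is obtained from the rule X → Y by a left I- or S-expansion with item i. -/
def IsLeftExp (X Y : Seqc I) (i : I) (X' : Seqc I) : Prop :=
  i ∉ itemsOf Y ∧
    ((X' = iExt X i ∧ ∀ a ∈ X.getLastD ∅, a < i) ∨ X' = sExt X i)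

/-- Y' is obtained from the rule X → Y by a right I- or S-expansion with item i. -/
def IsRightExp (X Y : Seqc I) (i : I) (Y' : Seqc I) : Prop :=
  i ∉ itemsOf X ∧
    ((Y' = iExt Y i ∧ ∀ a ∈ Y.getLastD ∅, a < i) ∨ Y' = sExt Y i)

/-- ULeft(r, s): sum of u(j, s) over items j of s such that some left
expansion of r with j occurs in s. -/
def ULeft (X Y s : Seqc I) : ℝ :=
  ∑ j ∈ (itemsOf s).filter
      (fun j => ∃ X', IsLeftExp X Y j X' ∧ RuleOccursIn X' Y s),
    itemUtil q iu j s

/-- LEPEU(r, s). -/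
def LEPEUs (X Y s : Seqc I) : ℝ :=
  if 0 < ULeft q iu X Y s then ruleUtilIn q iu X Y s + ULeft q iu X Y s else 0

/-- LEPEU(r) = Σ_{s ∈ seq(r)} LEPEU(r, s). -/
def LEPEU (D : List (Seqc I)) (X Y : Seqc I) : ℝ :=
  ((seqL D X Y).map (LEPEUs q iu X Y)).sum

/-- URight(r, s): sum of u(j, s) over items j of s such that some right
expansion of r with j occurs in s. -/
def URight (X Y s : Seqc I) : ℝ :=
  ∑ j ∈ (itemsOf s).filter
      (fun j => ∃ Y', IsRightExp X Y j Y' ∧ RuleOccursIn X Y' s),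
    itemUtil q iu j s

/-- REPEU(r, s). -/
def REPEUs (X Y s : Seqc I) : ℝ :=
  if 0 < URight q iu X Y s then ruleUtilIn q iu X Y s + URight q iu X Y s else 0

/-- REPEU(r) = Σ_{s ∈ seq(r)} REPEU(r, s). -/
def REPEU (D : List (Seqc I)) (X Y : Seqc I) : ℝ :=
  ((seqL D X Y).map (REPEUs q iu X Y)).sum

/-- j occurs strictly after i in s: in a strictly later itemset, or in the
same itemset and strictly greater in the item order. -/
def AfterIn (s : Seqc I) (i j : I) : Prop :=
  ∃ a b : Fin s.length, i ∈ s.get a ∧ j ∈ s.get b ∧ (a < b ∨ (a = b ∧ i < j))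

/-- UILeft(r, i, s): u(i, s) plus the sum of u(j, s) over items j of s
occurring strictly after i such that some left expansion of r with j occurs in s. -/
def UILeft (X Y : Seqc I) (i : I) (s : Seqc I) : ℝ :=
  itemUtil q iu i s +
    ∑ j ∈ (itemsOf s).filter
        (fun j => AfterIn s i j ∧ ∃ X', IsLeftExp X Y j X' ∧ RuleOccursIn X' Y s),
      itemUtil q iu j s

/-- LERSPEU(r') = Σ_{s ∈ seq(r')} (u(r, s) + UILeft(r, i, s)), where r' = X⋄i → Y. -/
def LERSPEU (D : List (Seqc I)) (X Y : Seqc I) (i : I) (X' : Seqc I) : ℝ :=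
  ((seqL D X' Y).map fun s => ruleUtilIn q iu X Y s + UILeft q iu X Y i s).sum

/-- UIRight(r, i, s): u(i, s) plus the sum of u(j, s) over items j of s
occurring strictly after i in s. -/
def UIRight (i : I) (s : Seqc I) : ℝ :=
  itemUtil q iu i s +
    ∑ j ∈ (itemsOf s).filter (fun j => AfterIn s i j), itemUtil q iu j s

/-- RERSPEU(r') = Σ_{s ∈ seq(r')} (u(r, s) + UIRight(r, i, s)), where r' = X → Y⋄i. -/
def RERSPEU (D : List (Seqc I)) (X Y : Seqc I) (i : I) (Y' : Seqc I) : ℝ :=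
  ((seqL D X Y').map fun s => ruleUtilIn q iu X Y s + UIRight q iu i s).sum

/-- The total utility of all items occurring in a sequence. -/
def totalUtil (s : Seqc I) : ℝ := ∑ j ∈ itemsOf s, itemUtil q iu j s

/-- SEU(i): sum, over the sequences of D in which item i occurs, of the
total utility of the sequence. -/
def SEUitem (D : List (Seqc I)) (i : I) : ℝ :=
  ((D.filter fun s => decide (i ∈ itemsOf s)).map (totalUtil q iu)).sum

/-- SEU(r): sum, over the sequences of D in which the rule r occurs, of the
total utility of the sequence. -/
def SEUrule (D : List (Seqc I)) (X Y : Seqc I) : ℝ :=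
  ((seqL D X Y).map (totalUtil q iu)).sum

/-- One expansion step on rules (as pairs (antecedent, consequent)):
either a left I- or S-expansion or a right I- or S-expansion with some item. -/
def ExpStep (p p' : Seqc I × Seqc I) : Prop :=
  (∃ i, IsLeftExp p.1 p.2 i p'.1 ∧ p'.2 = p.2) ∨
    (∃ i, IsRightExp p.1 p.2 i p'.2 ∧ p'.1 = p.1)

theorem mem_itemsOf {s : Seqc I} {j : I} : j ∈ itemsOf s ↔ ∃ e ∈ s, j ∈ e := by
  induction s with
  | nil => simp [itemsOf]
  | cons e s ih =>
    have h : itemsOf (e :: s) = e ∪ itemsOf s := rfl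
    simp [h, ih]

theorem itemsOf_append (s t : Seqc I) : itemsOf (s ++ t) = itemsOf s ∪ itemsOf t := by
  ext j
  simp [mem_itemsOf, or_and_right, exists_or]

theorem OccursIn.itemsOf_subset {s t : Seqc I} (h : OccursIn s t) : itemsOf s ⊆ itemsOf t := by
  obtain ⟨w, hw, hf⟩ := h
  have key : itemsOf s ⊆ itemsOf w := by
    clear hw
    induction hf with
    | nil => exact subset_rfl
    | cons h _ ih => exact Finset.union_subset_union h ih
  intro j hj
  obtain ⟨e, he, hje⟩ := mem_itemsOf.1 (key hj)
  exact mem_itemsOf.2 ⟨e, hw.subset he, hje⟩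

omit [LinearOrder I] in
theorem OccursIn.mono_right {s t t' : Seqc I} (h : OccursIn s t) (ht : t.Sublist t') :
    OccursIn s t' := by
  obtain ⟨w, hw, hf⟩ := h
  exact ⟨w, hw.trans ht, hf⟩

omit [LinearOrder I] in
theorem OccursIn.append {s t s' t' : Seqc I} (h : OccursIn s t) (h' : OccursIn s' t') :
    OccursIn (s ++ s') (t ++ t') := by
  obtain ⟨w, hw, hf⟩ := h
  obtain ⟨w', hw', hf'⟩ := h'
  exact ⟨w ++ w', hw.append hw', List.rel_append hf hf'⟩

omit [LinearOrder I] in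
theorem occursIn_singleton {e : Finset I} {t : Seqc I} {E : Finset I} (hE : E ∈ t) (h : e ⊆ E) :
    OccursIn [e] t :=
  ⟨[E], List.singleton_sublist.2 hE, by simpa using h⟩

omit [LinearOrder I] in
theorem OccursIn.exists_of_append_singleton {A t : Seqc I} {e : Finset I}
    (h : OccursIn (A ++ [e]) t) :
    ∃ t₁ E t₂, t = t₁ ++ E :: t₂ ∧ OccursIn A t₁ ∧ e ⊆ E := by
  obtain ⟨w, hw, hf⟩ := h
  rw [← List.forall₂_reverse_iff, List.reverse_append] at hf
  obtain ⟨E, v, hEe, hv, hwv⟩ := List.forall₂_cons_left_iff.1 hf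
  obtain rfl : w = v.reverse ++ [E] := by
    rw [← List.reverse_reverse w, hwv, List.reverse_cons]
  obtain ⟨r₁, r₂, rfl, h₁, h₂⟩ := List.append_sublist_iff.1 hw
  obtain ⟨p, u, rfl⟩ := List.append_of_mem (List.singleton_sublist.1 h₂)
  refine ⟨r₁ ++ p, E, u, by simp, ⟨v.reverse, h₁.trans (List.sublist_append_left _ _), ?_⟩, hEe⟩
  rw [← List.forall₂_reverse_iff, List.reverse_reverse]
  exact hv

/-- In a sequence with pairwise disjoint itemsets, an item after `i` lies either in the itemset
of `i`, above `i`, or in a later itemset. -/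
theorem AfterIn.mem_or_mem_itemsOf {P R : Seqc I} {E : Finset I} {i j : I}
    (hs : (P ++ E :: R).Pairwise fun a b => Disjoint a b) (hi : i ∈ E)
    (h : AfterIn (P ++ E :: R) i j) : (j ∈ E ∧ i < j) ∨ j ∈ itemsOf R := by
  obtain ⟨⟨a, ha⟩, ⟨b, hb⟩, hia, hjb, hab⟩ := h
  simp only [List.get_eq_getElem, Fin.mk_lt_mk, Fin.mk.injEq] at hia hjb hab
  have hP : P.length < (P ++ E :: R).length := by simp
  have hPE : (P ++ E :: R)[P.length] = E := by simp
  have hi' : i ∈ (P ++ E :: R)[P.length] := by rwa [hPE]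
  rw [List.pairwise_iff_getElem] at hs
  obtain rfl : a = P.length := by
    rcases lt_trichotomy a P.length with h | h | h
    · exact absurd hi' (Finset.disjoint_left.1 (hs _ _ ha hP h) hia)
    · exact h
    · exact absurd hia (Finset.disjoint_left.1 (hs _ _ hP ha h) hi')
  rcases hab with h | ⟨rfl, h⟩
  · right
    refine mem_itemsOf.2 ⟨_, ?_, hjb⟩
    rw [List.getElem_append_right h.le, List.getElem_cons, dif_neg (by omega)]
    exact List.getElem_mem _
  · left
    exact ⟨hPE ▸ hjb, h⟩

omit [LinearOrder I] in
theorem dropLast_append_getLastD {Y : Seqc I} (hY : Y ≠ []) :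
    Y.dropLast ++ [Y.getLastD ∅] = Y := by
  rw [List.getLastD_eq_getLast?, List.getLast?_eq_some_getLast hY, Option.getD_some,
    List.dropLast_append_getLast]

theorem OccursIn.of_isRightExp {X Y Y' t : Seqc I} {i : I} (hY : Y ≠ [])
    (h : IsRightExp X Y i Y') (ho : OccursIn Y' t) : OccursIn Y t := by
  obtain ⟨-, ⟨rfl, -⟩ | rfl⟩ := h
  · obtain ⟨t₁, E, t₂, rfl, hA, hE⟩ := OccursIn.exists_of_append_singleton ho
    rw [← dropLast_append_getLastD hY]
    exact hA.append (occursIn_singleton List.mem_cons_self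
      ((Finset.subset_insert _ _).trans hE))
  · obtain ⟨t₁, E, t₂, rfl, hA, -⟩ := OccursIn.exists_of_append_singleton ho
    exact hA.mono_right (List.sublist_append_left _ _)

theorem RuleOccursIn.of_isRightExp {X Y Y' s : Seqc I} {i : I} (hY : Y ≠ [])
    (h : IsRightExp X Y i Y') (ho : RuleOccursIn X Y' s) : RuleOccursIn X Y s := by
  obtain ⟨k, h₁, h₂, hX, hY'⟩ := ho
  exact ⟨k, h₁, h₂, hX, hY'.of_isRightExp hY h⟩

theorem IsRightExp.mem_itemsOf {X Y Y' : Seqc I} {i : I} (h : IsRightExp X Y i Y') :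
    i ∈ itemsOf Y' := by
  obtain ⟨-, ⟨rfl, -⟩ | rfl⟩ := h
  · simp [TotalSR.mem_itemsOf, iExt]
  · simp [TotalSR.mem_itemsOf, sExt]

theorem RuleOccursIn.itemsOf_union_subset {X Y s : Seqc I} (h : RuleOccursIn X Y s) :
    itemsOf X ∪ itemsOf Y ⊆ itemsOf s := by
  obtain ⟨k, -, -, hX, hY⟩ := h
  rw [← List.take_append_drop k s, itemsOf_append]
  exact Finset.union_subset_union hX.itemsOf_subset hY.itemsOf_subset

/-- Every item after `i` in a sequence where a right expansion with `i` occurs is itself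
a right-expansion item for that sequence. -/
theorem AfterIn.exists_isRightExp {X Y Y' s : Seqc I} {i j : I} (hY : Y ≠ [])
    (hs : s.Pairwise fun a b => Disjoint a b) (h : IsRightExp X Y i Y')
    (ho : RuleOccursIn X Y' s) (hij : AfterIn s i j) :
    ∃ Y'', IsRightExp X Y j Y'' ∧ RuleOccursIn X Y'' s := by
  obtain ⟨k, h₁, h₂, hXk, hYk⟩ := ho
  have hj_notMem : j ∈ itemsOf (s.drop k) → j ∉ itemsOf X := fun hj hjX => by
    rw [← List.take_append_drop k s, List.pairwise_append] at hs
    obtain ⟨e, he, hje⟩ := mem_itemsOf.1 (hXk.itemsOf_subset hjX)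
    obtain ⟨f, hf, hjf⟩ := mem_itemsOf.1 hj
    exact Finset.disjoint_left.1 (hs.2.2 e he f hf) hje hjf
  have after_of_split {t₁ t₂ : Seqc I} {E : Finset I} (ht : s.drop k = t₁ ++ E :: t₂)
      (hi : i ∈ E) : (j ∈ E ∧ i < j) ∨ j ∈ itemsOf t₂ := by
    have hst : s = (s.take k ++ t₁) ++ E :: t₂ := by
      rw [List.append_assoc, ← ht, List.take_append_drop]
    rw [hst] at hs hij
    exact hij.mem_or_mem_itemsOf hs hi
  obtain ⟨-, ⟨rfl, hlt⟩ | rfl⟩ := h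
  · obtain ⟨t₁, E, t₂, ht, hA, hE⟩ := OccursIn.exists_of_append_singleton hYk
    rw [Finset.insert_subset_iff] at hE
    rcases after_of_split ht hE.1 with ⟨hjE, hlt'⟩ | hj
    · refine ⟨iExt Y j, ⟨hj_notMem ?_, .inl ⟨rfl, fun a ha => (hlt a ha).trans hlt'⟩⟩,
        k, h₁, h₂, hXk, ?_⟩
      · exact mem_itemsOf.2 ⟨E, by simp [ht], hjE⟩
      · rw [ht]
        exact hA.append (occursIn_singleton List.mem_cons_self
          (Finset.insert_subset hjE hE.2))
    · obtain ⟨F, hF, hjF⟩ := mem_itemsOf.1 hj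
      refine ⟨sExt Y j, ⟨hj_notMem ?_, .inr rfl⟩, k, h₁, h₂, hXk, ?_⟩
      · exact mem_itemsOf.2 ⟨F, by simp [ht, hF], hjF⟩
      · have hYt : OccursIn Y (t₁ ++ [E]) := by
          rw [← dropLast_append_getLastD hY]
          exact hA.append (occursIn_singleton List.mem_cons_self hE.2)
        rw [ht, List.append_cons]
        exact hYt.append (occursIn_singleton hF (by simpa using hjF))
  · obtain ⟨t₁, E, t₂, ht, hA, hE⟩ := OccursIn.exists_of_append_singleton hYk
    obtain ⟨F, hF, hjF⟩ : ∃ F ∈ E :: t₂, j ∈ F := by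
      rcases after_of_split ht (Finset.singleton_subset_iff.1 hE) with ⟨hjE, -⟩ | hj
      · exact ⟨E, List.mem_cons_self, hjE⟩
      · obtain ⟨F, hF, hjF⟩ := mem_itemsOf.1 hj
        exact ⟨F, List.mem_cons_of_mem _ hF, hjF⟩
    refine ⟨sExt Y j, ⟨hj_notMem ?_, .inr rfl⟩, k, h₁, h₂, hXk, ?_⟩
    · exact mem_itemsOf.2 ⟨F, ht ▸ List.mem_append_right _ hF, hjF⟩
    · rw [ht]
      exact hA.append (occursIn_singleton hF (by simpa using hjF))

theorem not_afterIn_self {s : Seqc I} (hs : s.Pairwise fun a b => Disjoint a b) (i : I) :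
    ¬ AfterIn s i i := by
  rintro ⟨a, b, ha, hb, hab | ⟨-, h⟩⟩
  · rw [List.pairwise_iff_get] at hs
    exact Finset.disjoint_left.1 (hs a b hab) ha hb
  · exact lt_irrefl i h

section Utility

variable {q iu}

theorem UIRight_le_URight {X Y Y' s : Seqc I} {i : I}
    (hpos : ∀ j ∈ itemsOf s, 0 < itemUtil q iu j s) (hY : Y ≠ [])
    (hs : s.Pairwise fun a b => Disjoint a b) (h : IsRightExp X Y i Y')
    (ho : RuleOccursIn X Y' s) : UIRight q iu i s ≤ URight q iu X Y s := by
  have his : i ∈ itemsOf s :=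
    ho.itemsOf_union_subset (Finset.mem_union_right _ h.mem_itemsOf)
  have hni : i ∉ (itemsOf s).filter (fun j => AfterIn s i j) := by
    simp [not_afterIn_self hs i]
  unfold UIRight URight
  rw [← Finset.sum_insert (f := fun j => itemUtil q iu j s) hni]
  refine Finset.sum_le_sum_of_subset_of_nonneg (fun j hj => ?_)
    fun j hj _ => (hpos j (Finset.mem_filter.1 hj).1).le
  rw [Finset.mem_insert, Finset.mem_filter] at hj
  rw [Finset.mem_filter]
  rcases hj with rfl | ⟨hjs, hij⟩
  · exact ⟨his, Y', h, ho⟩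
  · exact ⟨hjs, hij.exists_isRightExp hY hs h ho⟩

theorem UIRight_pos {s : Seqc I} {i : I} (hpos : ∀ j ∈ itemsOf s, 0 < itemUtil q iu j s)
    (hi : i ∈ itemsOf s) : 0 < UIRight q iu i s :=
  add_pos_of_pos_of_nonneg (hpos i hi)
    (Finset.sum_nonneg fun j hj => (hpos j (Finset.mem_filter.1 hj).1).le)

theorem REPEUs_nonneg {X Y s : Seqc I} (hpos : ∀ j ∈ itemsOf s, 0 < itemUtil q iu j s)
    (ho : RuleOccursIn X Y s) : 0 ≤ REPEUs q iu X Y s := by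
  unfold REPEUs
  split_ifs with h
  · exact add_nonneg
      (Finset.sum_nonneg fun j hj => (hpos j (ho.itemsOf_union_subset hj)).le) h.le
  · exact le_rfl

end Utility

theorem sum_map_filter_le_sum_map_filter {α : Type*} (l : List α) (p p' : α → Bool) (f : α → ℝ)
    (hp : ∀ a ∈ l, p' a → p a) (hf : ∀ a ∈ l, p a → 0 ≤ f a) :
    ((l.filter p').map f).sum ≤ ((l.filter p).map f).sum := by
  have h : l.filter p' = (l.filter p).filter p' := by
    rw [List.filter_filter]
    refine List.filter_congr fun a ha => ?_
    have := hp a ha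
    cases h' : p' a <;> simp_all
  rw [h]
  refine List.Sublist.sum_le_sum (List.filter_sublist.map f) fun x hx => ?_
  obtain ⟨a, ha, rfl⟩ := List.mem_map.1 hx
  rw [List.mem_filter] at ha
  exact hf a ha.1 ha.2

/-- for a right expansion r' of r = X → Y with item i, the three
right-expansion upper bounds form a chain: RERSPEU(r') ≤ RERSU(r') ≤ REPEU(r),
where RERSU(r') = Σ_{s ∈ seq(r')} REPEU(r, s). -/
theorem right_upper_bounds_chain
    (hiu : ∀ j : I, 0 < iu j)
    (hq : ∀ (j : I) (s : Seqc I), j ∈ itemsOf s → 0 < q j s)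
    (D : List (Seqc I)) (hD : ∀ s ∈ D, WFSeq s)
    (X Y : Seqc I) (hX : WFSeq X) (hY : WFSeq Y)
    (hXY : Disjoint (itemsOf X) (itemsOf Y))
    (i : I) (Y' : Seqc I) (hexp : IsRightExp X Y i Y')
    (hY' : WFSeq Y') (hXY' : Disjoint (itemsOf X) (itemsOf Y')) :
    RERSPEU q iu D X Y i Y' ≤ ((seqL D X Y').map (REPEUs q iu X Y)).sum ∧
    ((seqL D X Y').map (REPEUs q iu X Y)).sum ≤ REPEU q iu D X Y := by
  have hpos : ∀ s : Seqc I, ∀ j ∈ itemsOf s, 0 < itemUtil q iu j s :=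
    fun s j hj => mul_pos (hq j s hj) (hiu j)
  constructor
  · refine List.sum_le_sum fun s hs => ?_
    rw [seqL, List.mem_filter, decide_eq_true_eq] at hs
    have hle := UIRight_le_URight (hpos s) hY.1 (hD s hs.1).2.2 hexp hs.2
    have hlt := UIRight_pos (hpos s)
      (hs.2.itemsOf_union_subset (Finset.mem_union_right _ hexp.mem_itemsOf))
    rw [REPEUs, if_pos (hlt.trans_le hle)]
    gcongr
  · refine sum_map_filter_le_sum_map_filter D _ _ _ (fun s _ hs => ?_) fun s _ hs => ?_
    · rw [decide_eq_true_eq] at hs ⊢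
      exact hs.of_isRightExp hY.1 hexp
    · exact REPEUs_nonneg (hpos s) (decide_eq_true_eq.mp hs)

end TotalSR
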